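/- arXiv:1902.07163 — 2 statements merged into one kernel-verified Lean document; each statement's English description precedes it below -/
import Mathlib

section
/- For real parameters with b3 ≠ 0, the pair (T_G, N_G) represents a Gaussian unitary (i.e. N_G = 0 and T_G·Ω·T_Gᵀ = Ω) if and only if a1 = a2 = a3 = 0 and b2 = b3. -/
open Matrix

/-- The one-mode symplectic form `Ω = !![0, 1; -1, 0]`. -/
noncomputable def Omega : Matrix (Fin 2) (Fin 2) ℝ := !![0, 1; -1, 0]

/-- A real `2 × 2` matrix rescales the symplectic form by its determinant. -/
theorem mul_Omega_mul_transpose (A : Matrix (Fin 2) (Fin 2) ℝ) :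
    A * Omega * Aᵀ = A.det • Omega := by
  ext i j
  fin_cases i <;> fin_cases j <;>
    simp [Omega, Matrix.mul_apply, Fin.sum_univ_two, det_fin_two] <;> ring

/-- A real `2 × 2` matrix is symplectic iff its determinant is `1`. -/
theorem mul_Omega_mul_transpose_eq_iff (A : Matrix (Fin 2) (Fin 2) ℝ) :
    A * Omega * Aᵀ = Omega ↔ A.det = 1 := by
  rw [mul_Omega_mul_transpose]
  constructor
  · intro h
    simpa [Omega] using congrFun (congrFun h 0) 1
  · intro h
    rw [h, one_smul]

/-- For `b3 ≠ 0`, the pair `(T_G, N_G)` of a Gaussian-functional-form channel represents a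
Gaussian unitary (`N_G = 0` and `T_G·Ω·T_Gᵀ = Ω`) iff `a1 = a2 = a3 = 0` and `b2 = b3`. -/
theorem stmt_8 (a1 a2 a3 b1 b2 b3 b4 : ℝ) (hb3 : b3 ≠ 0) :
    (let T_G : Matrix (Fin 2) (Fin 2) ℝ :=
        !![-b4 / b3, 1 / b3; b1 * b4 / b3 - b2, -b1 / b3]
     let N_G : Matrix (Fin 2) (Fin 2) ℝ :=
        !![2 * a3 / b3 ^ 2, a2 / b3 - 2 * a3 * b1 / b3 ^ 2;
           a2 / b3 - 2 * a3 * b1 / b3 ^ 2,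
           -2 * (-(a3 * b1 ^ 2 / b3 ^ 2) + a2 * b1 / b3 - a1)]
     N_G = 0 ∧ T_G * Omega * T_Gᵀ = Omega) ↔
      (a1 = 0 ∧ a2 = 0 ∧ a3 = 0 ∧ b2 = b3) := by
  dsimp only
  have hdet : (!![-b4 / b3, 1 / b3; b1 * b4 / b3 - b2, -b1 / b3] :
      Matrix (Fin 2) (Fin 2) ℝ).det = b2 / b3 := by
    rw [det_fin_two_of]
    field_simp
    ring
  rw [mul_Omega_mul_transpose_eq_iff, hdet, div_eq_one_iff_eq hb3]
  constructor
  · rintro ⟨hN, hb⟩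
    have h00 := congrFun (congrFun hN 0) 0
    have h01 := congrFun (congrFun hN 0) 1
    have h11 := congrFun (congrFun hN 1) 1
    have ha3 : a3 = 0 := by simpa [hb3] using h00
    subst ha3
    have ha2 : a2 = 0 := by simpa [hb3] using h01
    subst ha2
    have ha1 : a1 = 0 := by simpa using h11
    exact ⟨ha1, rfl, rfl, hb⟩
  · rintro ⟨rfl, rfl, rfl, hb⟩
    refine ⟨?_, hb⟩
    ext i j
    fin_cases i <;> fin_cases j <;> simp
end

section
/- Let β ≠ 0, γ ≠ 0 and let α, η, φ, P11 be real numbers. Set T = !![-η/γ, 0; φ, -α/β] and N = !![0, 0; 0, -2P11]. Then C(T,N) is positive semidefinite if and only if α·η = β·γ and P11 ≤ 0. In particular, this complete-positivity condition does not depend on the entry φ. -/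
open Matrix Complex
open scoped ComplexOrder

/-- The complete-positivity matrix `C(T,N) = N + i·Ω − i·T·Ω·Tᵀ`, real matrices viewed as
complex via the canonical embedding. -/
noncomputable def Cmat (T N : Matrix (Fin 2) (Fin 2) ℝ) : Matrix (Fin 2) (Fin 2) ℂ :=
  N.map (fun x => (x : ℂ)) + Complex.I • (Omega.map (fun x => (x : ℂ)))
    - Complex.I • ((T * Omega * Tᵀ).map (fun x => (x : ℂ)))


theorem Cmat_eq (T : Matrix (Fin 2) (Fin 2) ℝ) (d : ℝ) :
    Cmat T !![0, 0; 0, d] =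
      !![0, I * ((1 - T.det : ℝ) : ℂ); -(I * ((1 - T.det : ℝ) : ℂ)), (d : ℂ)] := by
  ext i j
  fin_cases i <;> fin_cases j <;>
    simp [Cmat, Omega, Matrix.mul_apply, Fin.sum_univ_two, Matrix.det_fin_two] <;> ring

theorem posSemidef_zero_corner_iff (c d : ℝ) :
    (!![0, I * (c : ℂ); -(I * (c : ℂ)), (d : ℂ)] : Matrix (Fin 2) (Fin 2) ℂ).PosSemidef ↔
      c = 0 ∧ 0 ≤ d := by
  constructor
  · intro h
    have hdet := h.det_nonneg
    have hd := h.diag_nonneg (i := 1)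
    have key : (!![0, I * (c : ℂ); -(I * (c : ℂ)), (d : ℂ)] : Matrix (Fin 2) (Fin 2) ℂ).det =
        ((-c ^ 2 : ℝ) : ℂ) := by
      rw [Matrix.det_fin_two_of]
      push_cast
      linear_combination (c : ℂ) ^ 2 * I_sq
    rw [key, Complex.zero_le_real] at hdet
    exact ⟨pow_eq_zero_iff two_ne_zero |>.mp (by nlinarith [sq_nonneg c]), by simpa using hd⟩
  · rintro ⟨rfl, hd⟩
    have key : (!![0, I * ((0 : ℝ) : ℂ); -(I * ((0 : ℝ) : ℂ)), (d : ℂ)] :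
        Matrix (Fin 2) (Fin 2) ℂ) = Matrix.diagonal ![0, (d : ℂ)] := by
      ext i j
      fin_cases i <;> fin_cases j <;> simp
    rw [key, Matrix.posSemidef_diagonal_iff]
    intro i
    fin_cases i <;> simp [hd]

/-- For `β ≠ 0`, `γ ≠ 0`, with `T = !![-η/γ, 0; φ, -α/β]` and `N = !![0, 0; 0, -2P11]`,
the matrix `C(T,N)` is positive semidefinite iff `α·η = β·γ` and `P11 ≤ 0`.
In particular the condition does not depend on `φ`. -/
theorem stmt_13 (β γ α η φ P11 : ℝ) (hβ : β ≠ 0) (hγ : γ ≠ 0) :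
    (Cmat (!![-η / γ, 0; φ, -α / β]) (!![0, 0; 0, -2 * P11])).PosSemidef ↔
      (α * η = β * γ ∧ P11 ≤ 0) := by
  rw [Cmat_eq, posSemidef_zero_corner_iff, Matrix.det_fin_two_of]
  refine and_congr ?_ (by constructor <;> intro h <;> linarith)
  have hdet : 1 - (-η / γ * (-α / β) - 0 * φ) = (β * γ - α * η) / (β * γ) := by
    field_simp
    ring
  rw [hdet, div_eq_zero_iff, or_iff_left (mul_ne_zero hβ hγ), sub_eq_zero, eq_comm]
end
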